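/- For every graph G, every base vertex v0, and every positive integer k, the k-th symmetric Abel-Jacobi map S^{(k)} : Div_+^k(G) → Jac(G) is injective if and only if G is (k+1)-edge-connected. -/

import Mathlib

open Finset

variable {V : Type}

def mdeg [Fintype V] (m : V → V → ℕ) (v : V) : ℕ := ∑ w, m v w

def laplacian [Fintype V] (m : V → V → ℕ) (f : V → ℤ) : V → ℤ :=
  fun v => (mdeg m v : ℤ) * f v - ∑ w, (m v w : ℤ) * f w

def LinEquiv [Fintype V] (m : V → V → ℕ) (D D' : V → ℤ) : Prop :=
  ∃ f : V → ℤ, D - D' = laplacian m f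

def Effective (D : V → ℤ) : Prop := ∀ v, 0 ≤ D v

def divDeg [Fintype V] (D : V → ℤ) : ℤ := ∑ v, D v

def edgeCount [Fintype V] (m : V → V → ℕ) : ℤ := (∑ v, ∑ w, (m v w : ℤ)) / 2

def genus [Fintype V] (m : V → V → ℕ) : ℤ := edgeCount m - Fintype.card V + 1

def IsGraph [Fintype V] (m : V → V → ℕ) : Prop :=
  (∀ v w, m v w = m w v) ∧ (∀ v, m v v = 0) ∧
  (SimpleGraph.fromRel (fun v w => 0 < m v w)).Connected

lemma laplacian_zero [Fintype V] (m : V → V → ℕ) : laplacian m (0 : V → ℤ) = 0 := by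
  funext v; simp [laplacian]

lemma laplacian_add [Fintype V] (m : V → V → ℕ) (f g : V → ℤ) :
    laplacian m (f + g) = laplacian m f + laplacian m g := by
  funext v
  simp only [laplacian, Pi.add_apply, mul_add, Finset.sum_add_distrib]
  ring

lemma laplacian_neg [Fintype V] (m : V → V → ℕ) (f : V → ℤ) :
    laplacian m (-f) = - laplacian m f := by
  funext v
  simp only [laplacian, Pi.neg_apply, mul_neg, Finset.sum_neg_distrib]
  ring

/-- Linear equivalence is an equivalence relation. -/
def linSetoid [Fintype V] (m : V → V → ℕ) : Setoid (V → ℤ) where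
  r := LinEquiv m
  iseqv := by
    constructor
    · intro D
      exact ⟨0, by rw [laplacian_zero]; simp⟩
    · rintro D D' ⟨f, hf⟩
      refine ⟨-f, ?_⟩
      rw [laplacian_neg, ← hf]
      abel
    · rintro D D' D'' ⟨f, hf⟩ ⟨g, hg⟩
      refine ⟨f + g, ?_⟩
      rw [laplacian_add, ← hf, ← hg]
      abel

/-- The setoid on degree-zero divisors induced by linear equivalence. -/
def jacSetoid [Fintype V] (m : V → V → ℕ) : Setoid {D : V → ℤ // divDeg D = 0} :=
  (linSetoid m).comap Subtype.val

/-- The Jacobian group of the graph, as the set of linear equivalence classes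
of degree-zero divisors. -/
def Jac [Fintype V] (m : V → V → ℕ) : Type _ := Quotient (jacSetoid m)

/-- The divisor `(v0)`. -/
def basisDiv [DecidableEq V] (v0 : V) : V → ℤ := fun v => if v = v0 then 1 else 0

lemma divDeg_basisDiv [Fintype V] [DecidableEq V] (v0 : V) :
    divDeg ((basisDiv v0 : V → ℤ)) = 1 := by
  simp [divDeg, basisDiv]

/-- The `k`-th symmetric power of the Abel–Jacobi map, defined on effective divisors of
degree `k`, sending `E` to the class of `E - k (v0)`. -/
def abelJacobi [Fintype V] [DecidableEq V] (m : V → V → ℕ) (v0 : V) (k : ℕ)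
    (E : {E : V → ℤ // Effective E ∧ divDeg E = (k : ℤ)}) : Jac m :=
  Quotient.mk (jacSetoid m) ⟨E.1 - (k : ℤ) • basisDiv v0, by
    have h1 : divDeg (E.1 - (k : ℤ) • basisDiv v0)
        = divDeg E.1 - (k : ℤ) * divDeg (basisDiv v0 : V → ℤ) := by
      simp [divDeg, Finset.sum_sub_distrib, Finset.mul_sum]
    rw [h1, divDeg_basisDiv, E.2.2]
    ring⟩

/-- `m` is `j`-edge-connected: removing any set of at most `j - 1` edges
(given by a symmetric submultiplicity function `w`, the number of removed edges being
`(∑ u, ∑ v, w u v) / 2`) leaves a connected graph. -/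
def EdgeConnected [Fintype V] (m : V → V → ℕ) (j : ℕ) : Prop :=
  ∀ w : V → V → ℕ, (∀ u v, w u v = w v u) → (∀ u v, w u v ≤ m u v) →
    (∑ u, ∑ v, w u v) ≤ 2 * (j - 1) →
    (SimpleGraph.fromRel (fun u v => w u v < m u v)).Connected

lemma conn_iff_cut [Fintype V] [DecidableEq V] [Nonempty V] (r : V → V → Prop)
    (hr : ∀ u v, r u v → r v u) :
    (SimpleGraph.fromRel r).Connected ↔
      ∀ A : Finset V, A.Nonempty → A ≠ univ → ∃ u ∈ A, ∃ v ∉ A, r u v := by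
  classical
  constructor
  · intro h A ⟨a, ha⟩ hA
    obtain ⟨b, hb⟩ : ∃ b, b ∉ A := by
      by_contra! hc
      exact hA (Finset.eq_univ_iff_forall.2 hc)
    obtain ⟨p⟩ := h.preconnected a b
    obtain ⟨d, -, h1, h2⟩ := p.exists_boundary_dart (A : Set V) (by simpa using ha) (by simpa using hb)
    have := d.adj
    rw [SimpleGraph.fromRel_adj] at this
    refine ⟨d.fst, by simpa using h1, d.snd, by simpa using h2, ?_⟩
    rcases this.2 with h | h
    · exact h
    · exact hr _ _ h
  · intro h
    refine ⟨?_⟩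
    intro a b
    by_contra hab
    obtain ⟨u, hu, v, hv, huv⟩ := h (univ.filter (fun x => (SimpleGraph.fromRel r).Reachable a x))
      ⟨a, by simp⟩ (by
        intro h
        have := Finset.mem_univ b
        rw [← h] at this
        simp at this
        exact hab this)
    simp only [mem_filter, mem_univ, true_and] at hu hv
    apply hv
    refine hu.trans (SimpleGraph.Adj.reachable ?_)
    rw [SimpleGraph.fromRel_adj]
    refine ⟨?_, Or.inl huv⟩
    rintro rfl
    exact hv hu

def cutSize [Fintype V] [DecidableEq V] (m : V → V → ℕ) (A : Finset V) : ℕ :=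
  ∑ u ∈ A, ∑ v ∈ Aᶜ, m u v

lemma cutSize_compl [Fintype V] [DecidableEq V] (m : V → V → ℕ) (hs : ∀ u v, m u v = m v u)
    (A : Finset V) : cutSize m Aᶜ = cutSize m A := by
  unfold cutSize
  rw [Finset.sum_comm, compl_compl]
  simp only [hs]

lemma two_cut_le [Fintype V] [DecidableEq V] (w : V → V → ℕ) (hs : ∀ u v, w u v = w v u)
    (A : Finset V) : ∑ u, ∑ v, w u v =
      2 * cutSize w A + ∑ u ∈ A, ∑ v ∈ A, w u v + ∑ u ∈ Aᶜ, ∑ v ∈ Aᶜ, w u v := by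
  have h1 : ∀ u, ∑ v, w u v = ∑ v ∈ A, w u v + ∑ v ∈ Aᶜ, w u v :=
    fun u => (Finset.sum_add_sum_compl A _).symm
  have h2 := cutSize_compl w hs A
  rw [← Finset.sum_add_sum_compl A]
  simp only [h1, Finset.sum_add_distrib]
  unfold cutSize at *
  rw [compl_compl] at h2
  omega

lemma edgeConnected_iff_cut [Fintype V] [DecidableEq V] [Nonempty V] (m : V → V → ℕ)
    (hs : ∀ u v, m u v = m v u) (k : ℕ) :
    EdgeConnected m (k + 1) ↔
      ∀ A : Finset V, A.Nonempty → A ≠ univ → k + 1 ≤ cutSize m A := by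
  constructor
  · intro h A hA hA'
    by_contra hlt
    set w : V → V → ℕ := fun u v => if (u ∈ A ↔ v ∈ A) then 0 else m u v with hw
    have hws : ∀ u v, w u v = w v u := by
      intro u v
      simp only [hw, hs u v, iff_comm]
    have hcut : cutSize w A = cutSize m A := by
      refine Finset.sum_congr rfl fun u hu => Finset.sum_congr rfl fun v hv => ?_
      rw [mem_compl] at hv
      simp [hw, hu, hv]
    have e1 : ∑ u ∈ A, ∑ v ∈ A, w u v = 0 :=
      Finset.sum_eq_zero fun u hu => Finset.sum_eq_zero fun v hv => by simp [hw, hu, hv]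
    have e2 : ∑ u ∈ Aᶜ, ∑ v ∈ Aᶜ, w u v = 0 :=
      Finset.sum_eq_zero fun u hu => Finset.sum_eq_zero fun v hv => by
        rw [mem_compl] at hu hv
        simp [hw, hu, hv]
    have hc := h w hws (by intro u v; simp only [hw]; split_ifs <;> simp) (by
      rw [two_cut_le w hws A, e1, e2, hcut]; omega)
    rw [conn_iff_cut _ (by intro u v; rw [hws u v, hs u v]; exact id)] at hc
    obtain ⟨u, hu, v, hv, huv⟩ := hc A hA hA'
    simp [hw, hu, hv] at huv
  · intro h w hws hle hsum
    rw [conn_iff_cut _ (by intro u v; rw [hws u v, hs u v]; exact id)]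
    intro A hA hA'
    by_contra! hc
    have h1 := h A hA hA'
    have h2 : cutSize m A ≤ cutSize w A :=
      Finset.sum_le_sum fun u hu => Finset.sum_le_sum fun v hv => hc u hu v (by simpa using hv)
    have h3 := two_cut_le w hws A
    omega

lemma laplacian_eq [Fintype V] (m : V → V → ℕ) (f : V → ℤ) (v : V) :
    laplacian m f v = ∑ w, (m v w : ℤ) * (f v - f w) := by
  simp only [laplacian, mdeg, mul_sub, Finset.sum_sub_distrib]
  push_cast
  rw [Finset.sum_mul]

lemma aj_eq_iff [Fintype V] [DecidableEq V] (m : V → V → ℕ) (v0 : V) (k : ℕ)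
    (D E : {E : V → ℤ // Effective E ∧ divDeg E = (k : ℤ)}) :
    abelJacobi m v0 k D = abelJacobi m v0 k E ↔ ∃ f, D.1 - E.1 = laplacian m f := by
  unfold abelJacobi
  refine Iff.trans Quotient.eq ?_
  change (∃ f, (D.1 - (k : ℤ) • basisDiv v0) - (E.1 - (k : ℤ) • basisDiv v0) = laplacian m f) ↔ _
  rw [sub_sub_sub_cancel_right]

def cutDiv [Fintype V] [DecidableEq V] (m : V → V → ℕ) (v0 : V) (k : ℕ) (A : Finset V) : V → ℤ :=
  fun v => (if v ∈ A then ∑ w ∈ Aᶜ, (m v w : ℤ) else 0) +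
    ((k : ℤ) - cutSize m A) * basisDiv v0 v

lemma cutDiv_prop [Fintype V] [DecidableEq V] (m : V → V → ℕ) (v0 : V) (k : ℕ) (A : Finset V)
    (h : cutSize m A ≤ k) :
    Effective (cutDiv m v0 k A) ∧ divDeg (cutDiv m v0 k A) = (k : ℤ) := by
  constructor
  · intro v
    unfold cutDiv basisDiv
    have h' : (cutSize m A : ℤ) ≤ k := by exact_mod_cast h
    have h1 : (0 : ℤ) ≤ if v ∈ A then ∑ w ∈ Aᶜ, (m v w : ℤ) else 0 := by
      split_ifs <;> positivity
    have h2 : (0 : ℤ) ≤ ((k : ℤ) - cutSize m A) * (if v = v0 then 1 else 0) := by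
      split_ifs <;> simp <;> omega
    omega
  · have := divDeg_basisDiv v0
    unfold divDeg cutDiv at *
    rw [Finset.sum_add_distrib, ← Finset.mul_sum, this]
    simp [cutSize]

theorem abelJacobi_injective_iff_edgeConnected [Fintype V] [DecidableEq V]
    (m : V → V → ℕ) (hm : IsGraph m) (v0 : V) (k : ℕ) (hk : 1 ≤ k) :
    Function.Injective (abelJacobi m v0 k) ↔ EdgeConnected m (k + 1) := by
  obtain ⟨hs, -, hconn⟩ := hm
  haveI : Nonempty V := ⟨v0⟩
  rw [conn_iff_cut _ (by intro u v; rw [hs u v]; exact id)] at hconn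
  rw [edgeConnected_iff_cut m hs k]
  constructor
  · intro hinj A hA hA'
    by_contra hlt
    have h1 : cutSize m A ≤ k := by omega
    have h2 : cutSize m Aᶜ ≤ k := by rw [cutSize_compl m hs]; exact h1
    have key := @hinj ⟨_, cutDiv_prop m v0 k A h1⟩ ⟨_, cutDiv_prop m v0 k Aᶜ h2⟩
      ((aj_eq_iff _ _ _ _ _).2 ⟨fun v => if v ∈ A then 1 else 0, by
        funext v
        rw [laplacian_eq, ← Finset.sum_add_sum_compl A]
        simp only [Pi.sub_apply, cutDiv, cutSize_compl m hs, compl_compl]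
        by_cases hv : v ∈ A
        · have e1 : ∑ x ∈ A, (m v x : ℤ) * ((if v ∈ A then 1 else 0) - if x ∈ A then 1 else 0) = 0 :=
            Finset.sum_eq_zero fun x hx => by simp [hv, hx]
          have e2 : ∑ x ∈ Aᶜ, (m v x : ℤ) * ((if v ∈ A then 1 else 0) - if x ∈ A then 1 else 0)
              = ∑ x ∈ Aᶜ, (m v x : ℤ) :=
            Finset.sum_congr rfl fun x hx => by rw [mem_compl] at hx; simp [hv, hx]
          rw [e1, e2]; simp [hv]
        · have e1 : ∑ x ∈ Aᶜ, (m v x : ℤ) * ((if v ∈ A then 1 else 0) - if x ∈ A then 1 else 0) = 0 :=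
            Finset.sum_eq_zero fun x hx => by rw [mem_compl] at hx; simp [hv, hx]
          have e2 : ∑ x ∈ A, (m v x : ℤ) * ((if v ∈ A then 1 else 0) - if x ∈ A then 1 else 0)
              = - ∑ x ∈ A, (m v x : ℤ) := by
            rw [← Finset.sum_neg_distrib]
            exact Finset.sum_congr rfl fun x hx => by simp [hv, hx]
          rw [e1, e2]; simp [hv]⟩)
    have key' := congrArg Subtype.val key
    obtain ⟨u, hu, v, hv, huv⟩ := hconn A hA hA'
    have := congrFun key' u
    simp only [cutDiv, cutSize_compl m hs, hu, mem_compl, not_true_eq_false, if_true, if_false] at this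
    have h3 : (m u v : ℤ) ≤ ∑ w ∈ Aᶜ, (m u w : ℤ) :=
      Finset.single_le_sum (f := fun w => (m u w : ℤ)) (fun _ _ => by positivity) (by simpa using hv)
    have : (0 : ℤ) < m u v := by exact_mod_cast huv
    linarith
  · intro hcut D E hDE
    obtain ⟨f, hf⟩ := (aj_eq_iff _ _ _ _ _).1 hDE
    obtain ⟨a, ha⟩ := Finite.exists_max f
    by_cases hA : univ.filter (fun v => f v = f a) = univ
    · have hcst : ∀ v, f v = f a := by simpa [Finset.filter_eq_self] using hA
      apply Subtype.ext
      rw [← sub_eq_zero, hf]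
      funext v
      rw [laplacian_eq]
      simp [hcst]
    · exfalso
      set A := univ.filter (fun v => f v = f a) with hAdef
      have h1 := hcut A ⟨a, by simp [hAdef]⟩ hA
      have h2 : (cutSize m A : ℤ) ≤ ∑ v ∈ A, (D.1 v - E.1 v) := by
        unfold cutSize
        push_cast
        refine Finset.sum_le_sum fun v hv => ?_
        have := congrFun hf v
        rw [Pi.sub_apply] at this
        rw [this, laplacian_eq]
        have hv' : f v = f a := by simpa [hAdef] using hv
        calc ∑ w ∈ Aᶜ, (m v w : ℤ) ≤ ∑ w ∈ Aᶜ, (m v w : ℤ) * (f v - f w) := by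
              refine Finset.sum_le_sum fun w hw => ?_
              have hw' : f w ≠ f a := by simpa [hAdef] using hw
              have : f w < f a := lt_of_le_of_ne (ha w) hw'
              have h0 : (0 : ℤ) ≤ m v w := by positivity
              nlinarith
          _ ≤ _ := Finset.sum_le_sum_of_subset_of_nonneg (Finset.subset_univ _) (by
              intro w _ _
              have := ha w
              exact mul_nonneg (by positivity) (by omega))
      have h3 : ∑ v ∈ A, (D.1 v - E.1 v) ≤ ∑ v ∈ A, D.1 v :=
        Finset.sum_le_sum fun v _ => by have := E.2.1 v; omega
      have h4 : ∑ v ∈ A, D.1 v ≤ ∑ v, D.1 v :=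
        Finset.sum_le_sum_of_subset_of_nonneg (Finset.subset_univ _) fun v _ _ => D.2.1 v
      have h5 : ∑ v, D.1 v = (k : ℤ) := D.2.2
      omega
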